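/- Define K(a, b) := (a²/2) ∫₀¹ tanh(b x)² dx. There exists a constant C > 0 such that lim_{n → ∞} ( √n / log n ) · ∫_{[0,1]²} exp( −n K(a, b) ) da db = C. That is, the deterministic normalized evidence Z̄_K(n) = ∫_{[0,1]²} e^{−n K(a,b)} da db of the 2-parameter tanh triplet with uniform prior satisfies Z̄_K(n) ∼ C · n^{−1/2} · log n as n → ∞. -/

import Mathlib

open MeasureTheory Filter

lemma aux_tanh_cont : Continuous Real.tanh := by
  have : Real.tanh = fun x => Real.sinh x / Real.cosh x := by
    funext x; exact Real.tanh_eq_sinh_div_cosh x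
  rw [this]
  exact Real.continuous_sinh.div Real.continuous_cosh (fun x => (Real.cosh_pos x).ne')

lemma aux_tanh_nonneg {u : ℝ} (hu : 0 ≤ u) : 0 ≤ Real.tanh u := by
  rw [Real.tanh_eq_sinh_div_cosh]
  exact div_nonneg (Real.sinh_nonneg_iff.2 hu) (Real.cosh_pos u).le

lemma aux_tanh_le {u : ℝ} (hu : 0 ≤ u) : Real.tanh u ≤ u := by
  rw [Real.tanh_eq_sinh_div_cosh, div_le_iff₀ (Real.cosh_pos u)]
  have hd : ∀ x : ℝ, HasDerivAt (fun x => x * Real.cosh x - Real.sinh x) (x * Real.sinh x) x := by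
    intro x
    have := ((hasDerivAt_id x).mul (Real.hasDerivAt_cosh x)).sub (Real.hasDerivAt_sinh x)
    exact HasDerivAt.congr_deriv this (by simp)
  have hm : MonotoneOn (fun x => x * Real.cosh x - Real.sinh x) (Set.Ici (0:ℝ)) := by
    apply monotoneOn_of_deriv_nonneg (convex_Ici 0)
    · exact fun x _ => (hd x).continuousAt.continuousWithinAt
    · exact fun x _ => (hd x).differentiableAt.differentiableWithinAt
    · intro x hx
      rw [interior_Ici] at hx
      rw [(hd x).deriv]
      exact mul_nonneg (le_of_lt hx) (Real.sinh_nonneg_iff.2 (le_of_lt hx))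
  have := hm (Set.mem_Ici.2 le_rfl) (Set.mem_Ici.2 hu) hu
  simp at this
  linarith

lemma aux_le_tanh {u : ℝ} (hu : 0 ≤ u) (hu1 : u ≤ 1) : u - u ^ 2 / 2 ≤ Real.tanh u := by
  rw [Real.tanh_eq_sinh_div_cosh, le_div_iff₀ (Real.cosh_pos u), Real.sinh_eq, Real.cosh_eq]
  have h1 := Real.quadratic_le_exp_of_nonneg (x := 2 * u) (by linarith)
  have h2 : Real.exp u = Real.exp (2 * u) * Real.exp (-u) := by
    rw [← Real.exp_add]; congr 1; ring
  have h3 := Real.exp_pos (-u)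
  rw [h2]
  set y := Real.exp (2 * u)
  set e := Real.exp (-u)
  have key : (u - u ^ 2 / 2) * (y + 1) ≤ y - 1 := by
    have hc : 0 ≤ 1 - (u - u ^ 2 / 2) := by nlinarith
    have h4 := mul_le_mul_of_nonneg_left h1 hc
    have h5 : 0 ≤ u ^ 2 * (1 - u + u ^ 2) := mul_nonneg (sq_nonneg u) (by nlinarith)
    nlinarith
  nlinarith [mul_le_mul_of_nonneg_left key h3.le]

/-- half of the integrated squared tanh -/
noncomputable def auxG (b : ℝ) : ℝ := 1 / 2 * ∫ x in (0:ℝ)..1, Real.tanh (b * x) ^ 2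

lemma auxG_cont : Continuous auxG := by
  unfold auxG
  refine continuous_const.mul ?_
  apply intervalIntegral.continuous_parametric_intervalIntegral_of_continuous'
  have := aux_tanh_cont
  fun_prop

lemma auxG_le {b : ℝ} (hb : 0 ≤ b) : auxG b ≤ b ^ 2 / 6 := by
  have h : (∫ x in (0:ℝ)..1, Real.tanh (b * x) ^ 2) ≤ ∫ x in (0:ℝ)..1, b ^ 2 * x ^ 2 := by
    apply intervalIntegral.integral_mono_on zero_le_one
    · exact ((aux_tanh_cont.comp (continuous_const.mul continuous_id)).pow 2).intervalIntegrable _ _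
    · exact Continuous.intervalIntegrable (by fun_prop) _ _
    · intro x hx
      have h0 : 0 ≤ b * x := mul_nonneg hb hx.1
      rw [← mul_pow]
      exact pow_le_pow_left₀ (aux_tanh_nonneg h0) (aux_tanh_le h0) 2
  rw [intervalIntegral.integral_const_mul, integral_pow] at h
  unfold auxG
  norm_num at h
  linarith

lemma auxG_ge {b : ℝ} (hb : 0 ≤ b) (hb1 : b ≤ 1) :
    b ^ 2 / 6 * (1 - 3 / 4 * b) ≤ auxG b := by
  have h : (∫ x in (0:ℝ)..1, (b ^ 2 * x ^ 2 - b ^ 3 * x ^ 3)) ≤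
      ∫ x in (0:ℝ)..1, Real.tanh (b * x) ^ 2 := by
    apply intervalIntegral.integral_mono_on zero_le_one
    · exact Continuous.intervalIntegrable (by fun_prop) _ _
    · exact ((aux_tanh_cont.comp (continuous_const.mul continuous_id)).pow 2).intervalIntegrable _ _
    · intro x hx
      have h0 : 0 ≤ b * x := mul_nonneg hb hx.1
      have h1 : b * x ≤ 1 := mul_le_one₀ hb1 hx.1 hx.2
      rw [← mul_pow, ← mul_pow]
      have h2 := aux_le_tanh h0 h1
      set u := b * x
      have h3 : 0 ≤ u - u ^ 2 / 2 := by nlinarith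
      have h4 := pow_le_pow_left₀ h3 h2 2
      have h5 : 0 ≤ (u ^ 2) ^ 2 := sq_nonneg _
      nlinarith
  rw [intervalIntegral.integral_sub (Continuous.intervalIntegrable (by fun_prop) _ _)
    (Continuous.intervalIntegrable (by fun_prop) _ _), intervalIntegral.integral_const_mul,
    intervalIntegral.integral_const_mul, integral_pow, integral_pow] at h
  unfold auxG
  norm_num at h
  nlinarith

lemma auxG_nonneg (b : ℝ) : 0 ≤ auxG b := by
  unfold auxG
  have := intervalIntegral.integral_nonneg (μ := volume) (zero_le_one (α := ℝ))
    (fun x _ => sq_nonneg (Real.tanh (b * x)))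
  linarith

/-- truncated Gaussian integral -/
noncomputable def auxF (c : ℝ) : ℝ := ∫ a in (0:ℝ)..1, Real.exp (-c * a ^ 2)

lemma auxF_cont : Continuous auxF := by
  unfold auxF
  apply intervalIntegral.continuous_parametric_intervalIntegral_of_continuous'
  fun_prop

lemma auxF_anti {c d : ℝ} (h : c ≤ d) : auxF d ≤ auxF c := by
  unfold auxF
  apply intervalIntegral.integral_mono_on zero_le_one
  · exact Continuous.intervalIntegrable (by fun_prop) _ _
  · exact Continuous.intervalIntegrable (by fun_prop) _ _
  · intro x hx
    apply Real.exp_le_exp.2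
    nlinarith [sq_nonneg x]

lemma auxF_nonneg (c : ℝ) : 0 ≤ auxF c :=
  intervalIntegral.integral_nonneg zero_le_one (fun x _ => (Real.exp_pos _).le)

lemma auxF_le_one {c : ℝ} (h : 0 ≤ c) : auxF c ≤ 1 := by
  have := auxF_anti h
  simpa [auxF] using this

lemma auxF_split {c : ℝ} (hc : 0 < c) :
    auxF c + ∫ a in Set.Ioi (1:ℝ), Real.exp (-c * a ^ 2) = √(Real.pi / c) / 2 := by
  have hi := integrable_exp_neg_mul_sq hc
  rw [← integral_gaussian_Ioi, auxF, intervalIntegral.integral_of_le zero_le_one,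
    ← setIntegral_union (Set.Ioc_disjoint_Ioi le_rfl) measurableSet_Ioi hi.integrableOn
      hi.integrableOn, Set.Ioc_union_Ioi_eq_Ioi zero_le_one]

lemma auxF_le {c : ℝ} (hc : 0 < c) : auxF c ≤ √(Real.pi / c) / 2 := by
  have := auxF_split hc
  have h2 : 0 ≤ ∫ a in Set.Ioi (1:ℝ), Real.exp (-c * a ^ 2) :=
    integral_nonneg (fun x => (Real.exp_pos _).le)
  linarith

lemma auxF_ge {c : ℝ} (hc : 0 < c) : √(Real.pi / c) / 2 - 1 / c ≤ auxF c := by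
  have := auxF_split hc
  have h2 : (∫ a in Set.Ioi (1:ℝ), Real.exp (-c * a ^ 2)) ≤
      ∫ a in Set.Ioi (1:ℝ), Real.exp (-c * a) := by
    apply setIntegral_mono_on (integrable_exp_neg_mul_sq hc).integrableOn
      (integrableOn_exp_mul_Ioi (by linarith) 1) measurableSet_Ioi
    intro x hx
    have hx : 1 < x := hx
    apply Real.exp_le_exp.2
    have : x ≤ x ^ 2 := by nlinarith
    nlinarith
  rw [integral_exp_mul_Ioi (by linarith)] at h2
  have h3 : -Real.exp (-c * 1) / -c ≤ 1 / c := by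
    rw [neg_div_neg_eq]
    gcongr
    rw [Real.exp_le_one_iff]; linarith
  linarith

/-- the constant -/
noncomputable def auxA : ℝ := √(6 * Real.pi) / 2

lemma auxA_pos : 0 < auxA := by unfold auxA; positivity

lemma auxFG_upper {t b : ℝ} (ht : 0 < t) (hb : 0 < b) (hb1 : b ≤ 1) :
    auxF (t ^ 2 * auxG b) ≤ auxA / t * (1 / b) + 3 * auxA / t := by
  have hg := auxG_ge hb.le hb1
  have hG : 0 < auxG b := lt_of_lt_of_le (mul_pos (by positivity) (by linarith)) hg
  refine (auxF_le (by positivity)).trans ?_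
  have : √(Real.pi / (t ^ 2 * auxG b)) ≤ √(6 * Real.pi) * ((1 + 3 * b) / (t * b)) := by
    apply Real.sqrt_le_iff.2 ⟨by positivity, ?_⟩
    rw [mul_pow, Real.sq_sqrt (by positivity), div_pow, mul_div_assoc',
      div_le_div_iff₀ (by positivity) (by positivity)]
    have h1 : b ^ 2 ≤ 6 * (1 + 3 * b) ^ 2 * auxG b := by
      have h2 : 1 ≤ (1 - 3 / 4 * b) * (1 + 3 * b) ^ 2 := by
        nlinarith [mul_nonneg hb.le (sub_nonneg.2 hb1), mul_nonneg (mul_nonneg hb.le hb.le) (sub_nonneg.2 hb1)]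
      have h3 := mul_le_mul_of_nonneg_left hg (by positivity : 0 ≤ 6 * (1 + 3 * b) ^ 2)
      have h4 := mul_le_mul_of_nonneg_left h2 (by positivity : 0 ≤ b ^ 2)
      nlinarith
    have h5 := mul_le_mul_of_nonneg_left h1 (by positivity : 0 ≤ Real.pi * t ^ 2)
    nlinarith
  have h2 : auxA / t * (1 / b) + 3 * auxA / t = √(6 * Real.pi) * ((1 + 3 * b) / (t * b)) / 2 := by
    unfold auxA; field_simp
  rw [h2]; linarith

lemma auxFG_lower {t b : ℝ} (ht : 0 < t) (hb : 0 < b) :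
    auxA / t * (1 / b) - 6 / t ^ 2 * (1 / b ^ 2) ≤ auxF (t ^ 2 * auxG b) := by
  have h1 : auxF (t ^ 2 * (b ^ 2 / 6)) ≤ auxF (t ^ 2 * auxG b) :=
    auxF_anti (mul_le_mul_of_nonneg_left (auxG_le hb.le) (sq_nonneg t))
  refine le_trans ?_ h1
  refine le_trans (le_of_eq ?_) (auxF_ge (by positivity))
  have : √(Real.pi / (t ^ 2 * (b ^ 2 / 6))) = √(6 * Real.pi) / (t * b) := by
    rw [show Real.pi / (t ^ 2 * (b ^ 2 / 6)) = (6 * Real.pi) / (t * b) ^ 2 by field_simp,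
      Real.sqrt_div (by positivity), Real.sqrt_sq (by positivity)]
  rw [this]
  unfold auxA
  field_simp

lemma auxJ_cont (t : ℝ) : Continuous (fun b => auxF (t ^ 2 * auxG b)) :=
  auxF_cont.comp (continuous_const.mul auxG_cont)

lemma auxJ_upper {t : ℝ} (ht : 1 ≤ t) :
    t * ∫ b in (0:ℝ)..1, auxF (t ^ 2 * auxG b) ≤ auxA * Real.log t + (1 + 3 * auxA) := by
  have ht0 : 0 < t := by linarith
  have hd : t⁻¹ ≤ 1 := inv_le_one_of_one_le₀ ht
  have hd0 : 0 < t⁻¹ := inv_pos.2 ht0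
  rw [← intervalIntegral.integral_add_adjacent_intervals (b := t⁻¹)
    ((auxJ_cont t).intervalIntegrable _ _) ((auxJ_cont t).intervalIntegrable _ _)]
  have h1 : (∫ b in (0:ℝ)..t⁻¹, auxF (t ^ 2 * auxG b)) ≤ ∫ b in (0:ℝ)..t⁻¹, (1:ℝ) := by
    apply intervalIntegral.integral_mono_on hd0.le ((auxJ_cont t).intervalIntegrable _ _)
      (continuous_const.intervalIntegrable _ _)
    intro x hx
    exact auxF_le_one (mul_nonneg (sq_nonneg t) (auxG_nonneg x))
  have hc : ContinuousOn (fun b : ℝ => auxA / t * (1 / b) + 3 * auxA / t) (Set.uIcc t⁻¹ 1) := by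
    rw [Set.uIcc_of_le hd]
    refine (continuousOn_const.mul (continuousOn_const.div continuousOn_id ?_)).add continuousOn_const
    intro x hx
    exact (hd0.trans_le hx.1).ne'
  have h2 : (∫ b in t⁻¹..1, auxF (t ^ 2 * auxG b)) ≤
      ∫ b in t⁻¹..1, (auxA / t * (1 / b) + 3 * auxA / t) := by
    apply intervalIntegral.integral_mono_on hd ((auxJ_cont t).intervalIntegrable _ _)
      hc.intervalIntegrable
    intro x hx
    exact auxFG_upper ht0 (hd0.trans_le hx.1) hx.2
  have h3 : ∫ b in t⁻¹..1, (auxA / t * (1 / b) + 3 * auxA / t) =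
      (auxA / t * Real.log 1 + 3 * auxA / t * 1) - (auxA / t * Real.log t⁻¹ + 3 * auxA / t * t⁻¹) := by
    apply intervalIntegral.integral_eq_sub_of_hasDerivAt (f := fun b =>
      auxA / t * Real.log b + 3 * auxA / t * b) _ hc.intervalIntegrable
    intro x hx
    rw [Set.uIcc_of_le hd] at hx
    have hx0 := hd0.trans_le hx.1
    have := ((Real.hasDerivAt_log hx0.ne').const_mul (auxA / t)).add
      ((hasDerivAt_id x).const_mul (3 * auxA / t))
    exact HasDerivAt.congr_deriv this (by simp)
  rw [h3] at h2
  simp only [Real.log_one, Real.log_inv] at h2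
  rw [intervalIntegral.integral_const] at h1
  simp only [sub_zero, smul_eq_mul, mul_one] at h1
  have h4 : 0 ≤ 3 * auxA / t * t⁻¹ := by have := auxA_pos; positivity
  have h5 := mul_le_mul_of_nonneg_left (add_le_add h1 h2) ht0.le
  refine h5.trans ?_
  have : t * (t⁻¹ + (auxA / t * 0 + 3 * auxA / t * 1 - (auxA / t * -Real.log t + 3 * auxA / t * t⁻¹)))
    = auxA * Real.log t + (1 + 3 * auxA) - t * (3 * auxA / t * t⁻¹) := by
    field_simp; ring
  rw [this]
  have := mul_nonneg ht0.le h4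
  linarith

lemma auxJ_lower {t : ℝ} (ht : 1 ≤ t) :
    auxA * Real.log t - 6 ≤ t * ∫ b in (0:ℝ)..1, auxF (t ^ 2 * auxG b) := by
  have ht0 : 0 < t := by linarith
  have hd : t⁻¹ ≤ 1 := inv_le_one_of_one_le₀ ht
  have hd0 : 0 < t⁻¹ := inv_pos.2 ht0
  rw [← intervalIntegral.integral_add_adjacent_intervals (b := t⁻¹)
    ((auxJ_cont t).intervalIntegrable _ _) ((auxJ_cont t).intervalIntegrable _ _)]
  have h1 : 0 ≤ (∫ b in (0:ℝ)..t⁻¹, auxF (t ^ 2 * auxG b)) :=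
    intervalIntegral.integral_nonneg hd0.le (fun x _ => auxF_nonneg _)
  have hc : ContinuousOn (fun b : ℝ => auxA / t * (1 / b) - 6 / t ^ 2 * (1 / b ^ 2))
      (Set.uIcc t⁻¹ 1) := by
    rw [Set.uIcc_of_le hd]
    refine (continuousOn_const.mul (continuousOn_const.div continuousOn_id ?_)).sub
      (continuousOn_const.mul (continuousOn_const.div (continuousOn_id.pow 2) ?_))
    · intro x hx
      exact (hd0.trans_le hx.1).ne'
    · intro x hx
      exact pow_ne_zero 2 (hd0.trans_le hx.1).ne'
  have h2 : (∫ b in t⁻¹..1, (auxA / t * (1 / b) - 6 / t ^ 2 * (1 / b ^ 2))) ≤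
      ∫ b in t⁻¹..1, auxF (t ^ 2 * auxG b) := by
    apply intervalIntegral.integral_mono_on hd hc.intervalIntegrable
      ((auxJ_cont t).intervalIntegrable _ _)
    intro x hx
    exact auxFG_lower ht0 (hd0.trans_le hx.1)
  have h3 : ∫ b in t⁻¹..1, (auxA / t * (1 / b) - 6 / t ^ 2 * (1 / b ^ 2)) =
      (auxA / t * Real.log 1 + 6 / t ^ 2 * (1:ℝ)⁻¹) -
      (auxA / t * Real.log t⁻¹ + 6 / t ^ 2 * (t⁻¹)⁻¹) := by
    apply intervalIntegral.integral_eq_sub_of_hasDerivAt (f := fun b =>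
      auxA / t * Real.log b + 6 / t ^ 2 * b⁻¹) _ hc.intervalIntegrable
    intro x hx
    rw [Set.uIcc_of_le hd] at hx
    have hx0 := hd0.trans_le hx.1
    have := ((Real.hasDerivAt_log hx0.ne').const_mul (auxA / t)).add
      ((hasDerivAt_inv hx0.ne').const_mul (6 / t ^ 2))
    exact HasDerivAt.congr_deriv this (by simp; ring)
  rw [h3] at h2
  simp only [Real.log_one, Real.log_inv, inv_one, inv_inv] at h2
  have h5 := mul_le_mul_of_nonneg_left (add_le_add h1 h2) ht0.le
  refine le_trans ?_ h5
  have : t * (0 + (auxA / t * 0 + 6 / t ^ 2 * 1 - (auxA / t * -Real.log t + 6 / t ^ 2 * t)))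
    = auxA * Real.log t - 6 + 6 / t := by
    field_simp; ring
  rw [this]
  have : 0 ≤ 6 / t := by positivity
  linarith



/-- For `K(a,b) = (a²/2) ∫₀¹ tanh(bx)² dx`, there is a constant
`C > 0` such that `(√n / log n) ∫_{[0,1]²} exp(-n K(a,b)) da db → C` as `n → ∞`; that
is, the deterministic normalized evidence of the 2-parameter tanh triplet with uniform
prior satisfies `Z̄_K(n) ∼ C n^{-1/2} log n`. -/
theorem stmt_15 (K : ℝ → ℝ → ℝ)
    (hK : ∀ a b, K a b = a ^ 2 / 2 * ∫ x in (0:ℝ)..1, Real.tanh (b * x) ^ 2) :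
    ∃ C : ℝ, 0 < C ∧
      Tendsto (fun n : ℕ =>
          Real.sqrt n / Real.log n
            * ∫ a in (0:ℝ)..1, ∫ b in (0:ℝ)..1, Real.exp (-(n : ℝ) * K a b))
        atTop (nhds C) := by
  have hswap : ∀ n : ℕ, (∫ a in (0:ℝ)..1, ∫ b in (0:ℝ)..1, Real.exp (-(n : ℝ) * K a b)) =
      ∫ b in (0:ℝ)..1, auxF (√(n:ℝ) ^ 2 * auxG b) := by
    intro n
    have hKG : ∀ a b, -(n : ℝ) * K a b = -(√(n:ℝ) ^ 2 * auxG b) * a ^ 2 := by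
      intro a b
      rw [hK, auxG, Real.sq_sqrt (Nat.cast_nonneg n)]
      ring
    simp_rw [hKG]
    rw [intervalIntegral_intervalIntegral_swap]
    · rfl
    · have hc : Continuous (Function.uncurry fun a b : ℝ =>
          Real.exp (-(√(n:ℝ) ^ 2 * auxG b) * a ^ 2)) := by
        have := auxG_cont
        unfold Function.uncurry
        fun_prop
      refine (hc.continuousOn.integrableOn_compact
        (isCompact_uIcc.prod isCompact_uIcc)).mono_set
        (Set.prod_mono Set.uIoc_subset_uIcc Set.uIoc_subset_uIcc)
  refine ⟨auxA / 2, by have := auxA_pos; positivity, ?_⟩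
  have hlog : Tendsto (fun n : ℕ => Real.log (n:ℝ)) atTop atTop :=
    Real.tendsto_log_atTop.comp tendsto_natCast_atTop_atTop
  have hlow : Tendsto (fun n : ℕ => auxA / 2 - 6 / Real.log (n:ℝ)) atTop (nhds (auxA / 2)) := by
    simpa using tendsto_const_nhds.sub (hlog.const_div_atTop 6)
  have hup : Tendsto (fun n : ℕ => auxA / 2 + (1 + 3 * auxA) / Real.log (n:ℝ)) atTop
      (nhds (auxA / 2)) := by
    simpa using tendsto_const_nhds.add (hlog.const_div_atTop (1 + 3 * auxA))
  refine tendsto_of_tendsto_of_tendsto_of_le_of_le' hlow hup ?_ ?_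
  · filter_upwards [eventually_ge_atTop 2] with n hn
    have hn' : (2:ℝ) ≤ n := by exact_mod_cast hn
    have hl : 0 < Real.log n := Real.log_pos (by linarith)
    have ht : 1 ≤ √(n:ℝ) := Real.one_le_sqrt.2 (by linarith)
    have h := auxJ_lower ht
    rw [Real.log_sqrt (Nat.cast_nonneg n)] at h
    rw [hswap, div_mul_eq_mul_div, le_div_iff₀ hl, sub_mul, div_mul_cancel₀ _ hl.ne']
    linarith
  · filter_upwards [eventually_ge_atTop 2] with n hn
    have hn' : (2:ℝ) ≤ n := by exact_mod_cast hn
    have hl : 0 < Real.log n := Real.log_pos (by linarith)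
    have ht : 1 ≤ √(n:ℝ) := Real.one_le_sqrt.2 (by linarith)
    have h := auxJ_upper ht
    rw [Real.log_sqrt (Nat.cast_nonneg n)] at h
    rw [hswap, div_mul_eq_mul_div, div_le_iff₀ hl, add_mul, div_mul_cancel₀ _ hl.ne']
    linarith
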